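/- arXiv:2002.00779 — 3 statements merged into one kernel-verified Lean document; each statement's English description precedes it below -/
import Mathlib

section
/- For random variables X and Y taking values in finite alphabets 𝒳 and 𝒴, and any γ ≥ 0, the infimum defining the relaxed Wyner's common information C_γ(X;Y) is attained, and it is attained by a random variable W whose alphabet 𝒲 can be restricted to satisfy |𝒲| ≤ |𝒳|·|𝒴| + 1. -/
open scoped BigOperators
open Classical

noncomputable section

/-- `p` is a probability mass function on the finite alphabet `α`. -/
def IsPMF {α : Type*} [Fintype α] (p : α → ℝ) : Prop :=
  (∀ a, 0 ≤ p a) ∧ ∑ a, p a = 1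

/-- Pushforward of a pmf under a map (distribution of `f(X)` when `X ~ p`). -/
noncomputable def pmfMap {α β : Type*} [Fintype α] (f : α → β) (p : α → ℝ) : β → ℝ :=
  fun b => ∑ a, if f a = b then p a else 0

/-- Shannon entropy (in nats) of a pmf on a finite alphabet. -/
noncomputable def Hent {α : Type*} [Fintype α] (p : α → ℝ) : ℝ :=
  ∑ a, Real.negMulLog (p a)

/-- Mutual information `I(X;Y)` of a joint pmf `p` of the pair `(X,Y)`. -/
noncomputable def mi {α β : Type*} [Fintype α] [Fintype β] (p : α × β → ℝ) : ℝ :=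
  Hent (pmfMap Prod.fst p) + Hent (pmfMap Prod.snd p) - Hent p

/-- Mutual information `I(X,Y;W)` of a joint pmf `q` of the triple `((X,Y),W)`. -/
noncomputable def miW {α β W : Type*} [Fintype α] [Fintype β] [Fintype W]
    (q : (α × β) × W → ℝ) : ℝ :=
  Hent (pmfMap Prod.fst q) + Hent (pmfMap Prod.snd q) - Hent q

/-- Conditional mutual information `I(X;Y|W)` of a joint pmf `q` of `((X,Y),W)`,
written as `H(X,W) + H(Y,W) - H(W) - H(X,Y,W)`. -/
noncomputable def cmi {α β W : Type*} [Fintype α] [Fintype β] [Fintype W]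
    (q : (α × β) × W → ℝ) : ℝ :=
  Hent (pmfMap (fun x => (x.1.1, x.2)) q) + Hent (pmfMap (fun x => (x.1.2, x.2)) q)
    - Hent (pmfMap Prod.snd q) - Hent q

/-- The set of values `I(X,Y;W)` over all finite-alphabet `W` jointly distributed with `(X,Y)`
(i.e. over all conditional distributions `p(w|x,y)`) such that `I(X;Y|W) ≤ γ`. -/
def relaxedSet {α β : Type*} [Fintype α] [Fintype β] (p : α × β → ℝ) (γ : ℝ) : Set ℝ :=
  { c | ∃ (m : ℕ) (q : (α × β) × Fin m → ℝ), IsPMF q ∧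
      (pmfMap Prod.fst q = p) ∧ cmi q ≤ γ ∧ c = miW q }

/-- Relaxed Wyner's common information `C_γ(X;Y)` of a joint pmf `p` of `(X,Y)`. -/
noncomputable def Cgamma {α β : Type*} [Fintype α] [Fintype β] (p : α × β → ℝ) (γ : ℝ) : ℝ :=
  sInf (relaxedSet p γ)

/-- Wyner's common information `C(X;Y)`: infimum of `I(X,Y;W)` over all finite-alphabet `W`
rendering `X` and `Y` conditionally independent, i.e. `I(X;Y|W) = 0`. -/
noncomputable def WynerCI {α β : Type*} [Fintype α] [Fintype β] (p : α × β → ℝ) : ℝ :=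
  sInf { c | ∃ (m : ℕ) (q : (α × β) × Fin m → ℝ), IsPMF q ∧
      (pmfMap Prod.fst q = p) ∧ cmi q = 0 ∧ c = miW q }

end

section Caratheodory

variable {ι E : Type*} [AddCommGroup E] [Module ℝ E] [FiniteDimensional ℝ E]

/-- Moving nonnegative weights along a linear relation until one of them vanishes. -/
theorem exists_weights_erase (u : ι → E) (c : ι → ℝ) (ℓ : E →ₗ[ℝ] ℝ) (s : Finset ι)
    (hℓ : ∀ i ∈ s, 0 < ℓ (u i)) (hs : Module.finrank ℝ E < s.card)
    (w : ι → ℝ) (hw : ∀ i ∈ s, 0 ≤ w i) :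
    ∃ j ∈ s, ∃ w' : ι → ℝ, (∀ i ∈ s, 0 ≤ w' i) ∧
      ∑ i ∈ s.erase j, w' i • u i = ∑ i ∈ s, w i • u i ∧
      ∑ i ∈ s, w i * c i ≤ ∑ i ∈ s.erase j, w' i * c i := by
  obtain ⟨d, hd, hd0, hdc⟩ : ∃ d : ι → ℝ, ∑ i ∈ s, d i • u i = 0 ∧ (∃ i ∈ s, d i ≠ 0) ∧
      0 ≤ ∑ i ∈ s, d i * c i := by
    have hdep : ¬ LinearIndepOn ℝ u (s : Set ι) := by
      intro h
      have := LinearIndependent.fintype_card_le_finrank h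
      simp at this
      omega
    obtain ⟨d, hd, i, hi, hdi⟩ := not_linearIndepOn_finset_iff.mp hdep
    rcases le_total 0 (∑ i ∈ s, d i * c i) with h | h
    · exact ⟨d, hd, ⟨i, hi, hdi⟩, h⟩
    · refine ⟨fun i => -d i, by simp [hd], ⟨i, hi, by simpa using hdi⟩, ?_⟩
      simpa using h
  have hneg : ∃ i ∈ s, d i < 0 := by
    by_contra! hcon
    have hsum : ∑ i ∈ s, d i * ℓ (u i) = 0 := by
      simpa using congrArg ℓ hd
    obtain ⟨i, hi, hdi⟩ := hd0
    have := (Finset.sum_eq_zero_iff_of_nonneg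
      (fun i hi => mul_nonneg (hcon i hi) (hℓ i hi).le)).mp hsum i hi
    exact (mul_ne_zero hdi (hℓ i hi).ne') this
  obtain ⟨j, hj, hmin⟩ := Finset.exists_min_image (s.filter fun i => d i < 0)
    (fun i => w i / (-d i)) (by
      obtain ⟨i, hi, hdi⟩ := hneg
      exact ⟨i, by simp [hi, hdi]⟩)
  obtain ⟨hjs, hdj⟩ := Finset.mem_filter.mp hj
  set r := w j / (-d j) with hr
  have hr0 : 0 ≤ r := div_nonneg (hw j hjs) (by linarith)
  have hj0 : w j + r * d j = 0 := by
    rw [hr]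
    field_simp [hdj.ne]
    ring
  refine ⟨j, hjs, fun i => w i + r * d i, fun i hi => ?_, ?_, ?_⟩
  · rcases lt_or_ge (d i) 0 with h | h
    · have h1 := hmin i (Finset.mem_filter.mpr ⟨hi, h⟩)
      rw [le_div_iff₀ (by linarith)] at h1
      linarith
    · have := mul_nonneg hr0 h
      have := hw i hi
      positivity
  · rw [Finset.sum_erase _ (by simp [hj0])]
    simp [add_smul, mul_smul, Finset.sum_add_distrib, ← Finset.smul_sum, hd]
  · rw [Finset.sum_erase _ (by simp [hj0])]
    simp only [add_mul, mul_assoc, Finset.sum_add_distrib, ← Finset.mul_sum]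
    have := mul_nonneg hr0 hdc
    linarith

/-- Conic Carathéodory theorem which does not decrease a linear objective. -/
theorem exists_weights_card_le_finrank (u : ι → E) (c : ι → ℝ) (ℓ : E →ₗ[ℝ] ℝ) (s : Finset ι)
    (hℓ : ∀ i ∈ s, 0 < ℓ (u i)) (w : ι → ℝ) (hw : ∀ i ∈ s, 0 ≤ w i) :
    ∃ t ⊆ s, t.card ≤ Module.finrank ℝ E ∧ ∃ w' : ι → ℝ, (∀ i ∈ t, 0 ≤ w' i) ∧
      ∑ i ∈ t, w' i • u i = ∑ i ∈ s, w i • u i ∧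
      ∑ i ∈ s, w i * c i ≤ ∑ i ∈ t, w' i * c i := by
  induction s using Finset.strongInduction generalizing w with
  | H s ih =>
    rcases le_or_gt s.card (Module.finrank ℝ E) with hs | hs
    · exact ⟨s, subset_rfl, hs, w, hw, rfl, le_rfl⟩
    · obtain ⟨j, hj, w₁, hw₁, hu₁, hc₁⟩ := exists_weights_erase u c ℓ s hℓ hs w hw
      obtain ⟨t, ht, hcard, w₂, hw₂, hu₂, hc₂⟩ := ih (s.erase j) (Finset.erase_ssubset hj)
        (fun i hi => hℓ i (Finset.mem_of_mem_erase hi)) w₁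
        (fun i hi => hw₁ i (Finset.mem_of_mem_erase hi))
      exact ⟨t, ht.trans (Finset.erase_subset _ _), hcard, w₂, hw₂, hu₂.trans hu₁, hc₁.trans hc₂⟩

end Caratheodory

/-- A finite family of nonnegative vectors can be replaced by one with at most `|A| + 1` members,
preserving the sum of the vectors and of the values of a homogeneous function `g`, without
decreasing the sum of the values of a homogeneous function `h`. -/
theorem exists_family_of_homogeneous {ι A : Type*} [Fintype ι] [Fintype A]
    {g h : (A → ℝ) → ℝ} (hg : ∀ (t : ℝ) v, g (t • v) = t * g v)
    (hh : ∀ (t : ℝ) v, h (t • v) = t * h v) {N : ℕ} (hN : Fintype.card A + 1 ≤ N)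
    (v : ι → A → ℝ) (hv : ∀ i a, 0 ≤ v i a) :
    ∃ v' : Fin N → A → ℝ, (∀ i a, 0 ≤ v' i a) ∧ ∑ i, v' i = ∑ i, v i ∧
      ∑ i, g (v' i) = ∑ i, g (v i) ∧ ∑ i, h (v i) ≤ ∑ i, h (v' i) := by
  have hg0 : g 0 = 0 := by simpa using hg 0 0
  have hh0 : h 0 = 0 := by simpa using hh 0 0
  set s : Finset ι := Finset.univ.filter fun i => v i ≠ 0 with hs
  have sum_s (F : (A → ℝ) → ℝ) (hF : F 0 = 0) :
      ∑ i ∈ s, F (v i) = ∑ i, F (v i) := by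
    refine Finset.sum_subset (Finset.subset_univ _) fun i _ hi => ?_
    have : v i = 0 := by simpa [hs] using hi
    rw [this, hF]
  let ℓ : (A → ℝ) × ℝ →ₗ[ℝ] ℝ := (∑ a, LinearMap.proj a) ∘ₗ LinearMap.fst ℝ (A → ℝ) ℝ
  have hℓ : ∀ i ∈ s, 0 < ℓ (v i, g (v i)) := by
    intro i hi
    have hne : v i ≠ 0 := (Finset.mem_filter.mp hi).2
    obtain ⟨a, ha⟩ := Function.ne_iff.mp hne
    have : 0 < ∑ a, v i a :=
      Finset.sum_pos' (fun a _ => hv i a) ⟨a, Finset.mem_univ _, (hv i a).lt_of_ne' ha⟩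
    simpa [ℓ] using this
  obtain ⟨t, -, hcard, w, hw, hu, hc⟩ := exists_weights_card_le_finrank
    (fun i => (v i, g (v i))) (fun i => h (v i)) ℓ s hℓ (fun _ => 1) (fun _ _ => zero_le_one)
  have hcard' : Fintype.card t ≤ Fintype.card (Fin N) := by
    simp at hcard ⊢
    omega
  obtain ⟨e⟩ := Function.Embedding.nonempty_of_card_le hcard'
  let v' : Fin N → A → ℝ := Function.extend e (fun i : t => w i • v i) 0
  have hout : ∀ k ∉ Set.range e, v' k = 0 := fun k hk => by
    simp only [v']
    rw [Function.extend_apply' _ _ _ (by simpa using hk)]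
    rfl
  have hin : ∀ i : t, v' (e i) = w i • v i := fun i => e.injective.extend_apply _ _ _
  have sum_v' (F : (A → ℝ) → ℝ) (hF : F 0 = 0) :
      ∑ k, F (v' k) = ∑ i ∈ t, F (w i • v i) := by
    rw [← Finset.sum_coe_sort t]
    exact (Fintype.sum_of_injective e e.injective _ _ (fun k hk => by rw [hout k hk, hF])
      (fun i => by rw [hin i])).symm
  refine ⟨v', fun k a => ?_, ?_, ?_, ?_⟩
  · by_cases hk : k ∈ Set.range e
    · obtain ⟨i, rfl⟩ := hk
      rw [hin i]
      exact mul_nonneg (hw i i.2) (hv i a)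
    · rw [hout k hk]
      rfl
  · funext a
    have h1 := congrFun (congrArg Prod.fst hu) a
    simp only [Prod.fst_sum, Prod.smul_fst, one_smul, Finset.sum_apply] at h1 ⊢
    exact (sum_v' (fun x => x a) rfl).trans (h1.trans (sum_s (fun x => x a) rfl))
  · have h1 := congrArg Prod.snd hu
    simp only [Prod.snd_sum, Prod.smul_snd, one_smul, smul_eq_mul] at h1
    rw [sum_v' g hg0, ← sum_s g hg0, ← h1]
    simp only [hg]
  · rw [sum_v' h hh0, ← sum_s h hh0]
    simpa only [hh, one_mul] using hc

section Slices

variable {α β : Type*} [Fintype α] [Fintype β]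

/-- For a nonnegative vector `v`, its total mass times the mutual information of the
normalization of `v`. -/
noncomputable def sliceMI (v : α × β → ℝ) : ℝ :=
  ∑ x, Real.negMulLog (∑ y, v (x, y)) + ∑ y, Real.negMulLog (∑ x, v (x, y))
    - Real.negMulLog (∑ a, v a) - ∑ a, Real.negMulLog (v a)

/-- For a nonnegative vector `v`, its total mass times the entropy of the normalization of `v`. -/
noncomputable def sliceEnt {A : Type*} [Fintype A] (v : A → ℝ) : ℝ :=
  ∑ a, Real.negMulLog (v a) - Real.negMulLog (∑ a, v a)

theorem sum_negMulLog_mul {A : Type*} [Fintype A] (t : ℝ) (v : A → ℝ) :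
    ∑ a, Real.negMulLog (t * v a) =
      (∑ a, v a) * Real.negMulLog t + t * ∑ a, Real.negMulLog (v a) := by
  simp only [Real.negMulLog_mul, Finset.sum_add_distrib, Finset.sum_mul, Finset.mul_sum]

theorem sliceEnt_smul {A : Type*} [Fintype A] (t : ℝ) (v : A → ℝ) :
    sliceEnt (t • v) = t * sliceEnt v := by
  simp only [sliceEnt, Pi.smul_apply, smul_eq_mul, sum_negMulLog_mul]
  simp only [← Finset.mul_sum, Real.negMulLog_mul]
  ring

theorem sliceMI_smul (t : ℝ) (v : α × β → ℝ) : sliceMI (t • v) = t * sliceMI v := by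
  have h1 : ∑ x, ∑ y, v (x, y) = ∑ a, v a := (Fintype.sum_prod_type _).symm
  have h2 : ∑ y, ∑ x, v (x, y) = ∑ a, v a := (Fintype.sum_prod_type_right _).symm
  simp only [sliceMI, Pi.smul_apply, smul_eq_mul, ← Finset.mul_sum]
  rw [sum_negMulLog_mul, sum_negMulLog_mul, sum_negMulLog_mul, Real.negMulLog_mul, h1, h2]
  ring

theorem sum_negMulLog_single {A : Type*} [Fintype A] [DecidableEq A] (a : A) (c : ℝ) :
    ∑ b, Real.negMulLog ((Pi.single a c : A → ℝ) b) = Real.negMulLog c := by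
  rw [Finset.sum_eq_single a (fun b _ hb => by simp [hb]) (by simp), Pi.single_eq_same]

theorem sliceMI_single (a : α × β) (c : ℝ) : sliceMI (Pi.single a c) = 0 := by
  obtain ⟨x₀, y₀⟩ := a
  have h1 : ∀ x, ∑ y, (Pi.single (x₀, y₀) c : α × β → ℝ) (x, y) =
      (Pi.single x₀ c : α → ℝ) x := by
    intro x
    by_cases hx : x = x₀ <;> simp [Pi.single_apply, hx]
  have h2 : ∀ y, ∑ x, (Pi.single (x₀, y₀) c : α × β → ℝ) (x, y) =
      (Pi.single y₀ c : β → ℝ) y := by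
    intro y
    by_cases hy : y = y₀ <;> simp [Pi.single_apply, hy]
  simp [sliceMI, h1, h2, sum_negMulLog_single]

variable {W : Type*} [Fintype W]

theorem pmfMap_fst {A : Type*} [Fintype A] (q : A × W → ℝ) (a : A) :
    pmfMap Prod.fst q a = ∑ w, q (a, w) := by
  rw [pmfMap, Fintype.sum_prod_type_right]
  simp

theorem pmfMap_snd {A : Type*} [Fintype A] (q : A × W → ℝ) (w : W) :
    pmfMap Prod.snd q w = ∑ a, q (a, w) := by
  rw [pmfMap, Fintype.sum_prod_type]
  simp

theorem pmfMap_fst_fst (q : (α × β) × W → ℝ) (x : α) (w : W) :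
    pmfMap (fun z => (z.1.1, z.2)) q (x, w) = ∑ y, q ((x, y), w) := by
  simp only [pmfMap, Fintype.sum_prod_type, Prod.mk.injEq, ite_and]
  simp [Finset.sum_ite_irrel]

theorem pmfMap_fst_snd (q : (α × β) × W → ℝ) (y : β) (w : W) :
    pmfMap (fun z => (z.1.2, z.2)) q (y, w) = ∑ x, q ((x, y), w) := by
  simp only [pmfMap, Fintype.sum_prod_type, Prod.mk.injEq, ite_and]
  simp [Finset.sum_ite_irrel]

theorem cmi_eq_sum_sliceMI (q : (α × β) × W → ℝ) :
    cmi q = ∑ w, sliceMI fun a => q (a, w) := by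
  simp only [cmi, Hent, sliceMI, Finset.sum_sub_distrib, Finset.sum_add_distrib]
  rw [Fintype.sum_prod_type_right (fun z : α × W => _),
    Fintype.sum_prod_type_right (fun z : β × W => _),
    Fintype.sum_prod_type_right (fun z : (α × β) × W => _)]
  simp only [pmfMap_fst_fst, pmfMap_fst_snd, pmfMap_snd]

theorem miW_eq_sub_sum_sliceEnt (q : (α × β) × W → ℝ) :
    miW q = Hent (pmfMap Prod.fst q) - ∑ w, sliceEnt fun a => q (a, w) := by
  have : Hent q = ∑ w, ∑ a, Real.negMulLog (q (a, w)) := Fintype.sum_prod_type_right _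
  simp only [miW, sliceEnt, Finset.sum_sub_distrib, this]
  simp only [Hent, pmfMap_snd]
  ring

theorem continuous_Hent {A : Type*} [Fintype A] : Continuous (Hent : (A → ℝ) → ℝ) := by
  unfold Hent
  exact continuous_finsetSum _ fun a _ => Real.continuous_negMulLog.comp (continuous_apply a)

theorem continuous_pmfMap {A B : Type*} [Fintype A] (f : A → B) :
    Continuous (pmfMap f : (A → ℝ) → B → ℝ) := by
  refine continuous_pi fun b => continuous_finsetSum _ fun a _ => ?_
  split_ifs
  · exact continuous_apply a
  · exact continuous_const

theorem continuous_cmi : Continuous (cmi : ((α × β) × W → ℝ) → ℝ) :=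
  (((continuous_Hent.comp (continuous_pmfMap _)).add
    (continuous_Hent.comp (continuous_pmfMap _))).sub
    (continuous_Hent.comp (continuous_pmfMap _))).sub continuous_Hent

theorem continuous_miW : Continuous (miW : ((α × β) × W → ℝ) → ℝ) :=
  ((continuous_Hent.comp (continuous_pmfMap _)).add
    (continuous_Hent.comp (continuous_pmfMap _))).sub continuous_Hent

theorem isCompact_setOf_isPMF {A : Type*} [Fintype A] : IsCompact {q : A → ℝ | IsPMF q} :=
  isCompact_stdSimplex ℝ A

theorem isPMF_of_pmfMap_fst_eq {A : Type*} [Fintype A] {p : A → ℝ} (hp : IsPMF p)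
    {q : A × W → ℝ} (hq : ∀ z, 0 ≤ q z) (hqp : pmfMap Prod.fst q = p) : IsPMF q := by
  refine ⟨hq, ?_⟩
  rw [Fintype.sum_prod_type, ← hp.2, ← hqp]
  simp only [pmfMap_fst]

/-- Cardinality reduction for the auxiliary variable. -/
theorem exists_slices_card_bound {p : α × β → ℝ} (hp : IsPMF p) {N : ℕ}
    (hN : Fintype.card α * Fintype.card β + 1 ≤ N) {q : (α × β) × W → ℝ} (hq : ∀ z, 0 ≤ q z)
    (hqp : pmfMap Prod.fst q = p) :
    ∃ q' : (α × β) × Fin N → ℝ, IsPMF q' ∧ pmfMap Prod.fst q' = p ∧ cmi q' = cmi q ∧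
      miW q' ≤ miW q := by
  obtain ⟨v, hv, hsum, hg, hh⟩ := exists_family_of_homogeneous (sliceMI_smul (α := α) (β := β))
    sliceEnt_smul (N := N) (by rwa [Fintype.card_prod]) (fun w a => q (a, w)) (fun w a => hq (a, w))
  have hqp' : pmfMap Prod.fst (fun z : (α × β) × Fin N => v z.2 z.1) = p := by
    rw [← hqp]
    funext a
    simpa [pmfMap_fst] using congrFun hsum a
  refine ⟨fun z => v z.2 z.1, isPMF_of_pmfMap_fst_eq hp (fun z => hv _ _) hqp', hqp', ?_, ?_⟩
  · simpa only [cmi_eq_sum_sliceMI] using hg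
  · simp only [miW_eq_sub_sum_sliceEnt, hqp, hqp']
    linarith

theorem exists_cmi_eq_zero {p : α × β → ℝ} (hp : IsPMF p) :
    ∃ q : (α × β) × (α × β) → ℝ, (∀ z, 0 ≤ q z) ∧ pmfMap Prod.fst q = p ∧ cmi q = 0 := by
  refine ⟨fun z => (Pi.single z.2 (p z.2) : α × β → ℝ) z.1, fun z => ?_, ?_, ?_⟩
  · exact (Pi.single_nonneg (α := fun _ : α × β => ℝ)).mpr (hp.1 z.2) z.1
  · funext a
    simp [pmfMap_fst, Pi.single_apply]
  · simp only [cmi_eq_sum_sliceMI, sliceMI_single, Finset.sum_const_zero]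

end Slices

/-- For random variables `X, Y` on finite alphabets `α, 𝒴` and any `γ ≥ 0`,
the infimum defining the relaxed Wyner's common information `C_γ(X;Y)` is attained, and it is
attained by a `W` whose alphabet can be restricted to have at most `|𝒳|·|𝒴| + 1` elements. -/
theorem relaxedWyner_attained_card_bound
    {α β : Type*} [Fintype α] [Fintype β] (p : α × β → ℝ) (hp : IsPMF p)
    (γ : ℝ) (hγ : 0 ≤ γ) :
    ∃ q : (α × β) × Fin (Fintype.card α * Fintype.card β + 1) → ℝ,
      IsPMF q ∧ pmfMap Prod.fst q = p ∧ cmi q ≤ γ ∧ miW q = Cgamma p γ := by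

  set N := Fintype.card α * Fintype.card β + 1 with hN
  let K : Set ((α × β) × Fin N → ℝ) :=
    {q | IsPMF q} ∩ {q | pmfMap Prod.fst q = p ∧ cmi q ≤ γ}
  have hK : IsCompact K := isCompact_setOf_isPMF.inter_right
    ((isClosed_eq (continuous_pmfMap _) continuous_const).inter
      (isClosed_le continuous_cmi continuous_const))
  have hne : K.Nonempty := by
    obtain ⟨q, hq, hqp, hc⟩ := exists_cmi_eq_zero hp
    obtain ⟨q', hq', hqp', hc', -⟩ := exists_slices_card_bound hp hN.ge hq hqp
    exact ⟨q', hq', hqp', by rwa [hc', hc]⟩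
  obtain ⟨q, ⟨hq, hqp, hc⟩, hmin⟩ := hK.exists_isMinOn hne continuous_miW.continuousOn
  refine ⟨q, hq, hqp, hc, Eq.symm (IsLeast.csInf_eq ⟨⟨N, q, hq, hqp, hc, rfl⟩, ?_⟩)⟩
  rintro _ ⟨m, r, hr, hrp, hrc, rfl⟩
  obtain ⟨r', hr', hrp', hrc', hle⟩ := exists_slices_card_bound hp hN.ge hr.1 hrp
  exact (hmin ⟨hr', hrp', hrc'.le.trans hrc⟩).trans hle
end

section
/- For random variables X and Y taking values in finite alphabets and any γ ≥ 0, the relaxed Wyner's common information satisfies C_γ(X;Y) ≥ 0, with equality if and only if γ ≥ I(X;Y), where I(X;Y) is the mutual information between X and Y. -/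
open scoped BigOperators
open Classical

lemma sum_pmfMap_mul {α β : Type*} [Fintype α] [Fintype β] (f : α → β) (q : α → ℝ) (g : β → ℝ) :
    ∑ b, pmfMap f q b * g b = ∑ a, q a * g (f a) := by
  simp only [pmfMap, Finset.sum_mul]
  rw [Finset.sum_comm]
  refine Finset.sum_congr rfl fun a _ => ?_
  simp [ite_mul]

lemma sum_pmfMap {α β : Type*} [Fintype α] [Fintype β] (f : α → β) (q : α → ℝ) :
    ∑ b, pmfMap f q b = ∑ a, q a := by
  simpa using sum_pmfMap_mul f q fun _ => 1

lemma pmfMap_comp {α β δ : Type*} [Fintype α] [Fintype β] (f : α → β) (g : β → δ) (q : α → ℝ) :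
    pmfMap g (pmfMap f q) = pmfMap (g ∘ f) q := by
  ext d
  simpa [pmfMap] using sum_pmfMap_mul f q fun b => if g b = d then 1 else 0

lemma pmfMap_nonneg {α β : Type*} [Fintype α] (f : α → β) {q : α → ℝ} (hq : ∀ a, 0 ≤ q a) (b : β) :
    0 ≤ pmfMap f q b :=
  Finset.sum_nonneg fun a _ => by split_ifs <;> simp [hq]

lemma le_pmfMap {α β : Type*} [Fintype α] (f : α → β) {q : α → ℝ} (hq : ∀ a, 0 ≤ q a) (a : α) :
    q a ≤ pmfMap f q (f a) := by
  have := Finset.single_le_sum (f := fun x => if f x = f a then q x else 0)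
    (fun x _ => by split_ifs <;> simp [hq]) (Finset.mem_univ a)
  simpa [pmfMap] using this

lemma pmfMap_apply_of_injective {α β : Type*} [Fintype α] {f : α → β} (hf : f.Injective)
    (q : α → ℝ) (a : α) : pmfMap f q (f a) = q a := by
  simp [pmfMap, hf.eq_iff]

lemma pmfMap_id {α : Type*} [Fintype α] (q : α → ℝ) : pmfMap (fun a => a) q = q := by
  ext a
  simp [pmfMap]

lemma IsPMF.pmfMap {α β : Type*} [Fintype α] [Fintype β] (f : α → β) {q : α → ℝ} (hq : IsPMF q) :
    IsPMF (pmfMap f q) :=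
  ⟨pmfMap_nonneg f hq.1, (sum_pmfMap f q).trans hq.2⟩

lemma Hent_pmfMap {α β : Type*} [Fintype α] [Fintype β] (f : α → β) (q : α → ℝ) :
    Hent (pmfMap f q) = -∑ a, q a * Real.log (pmfMap f q (f a)) := by
  rw [← sum_pmfMap_mul f q fun b => Real.log (pmfMap f q b)]
  simp [Hent, Real.negMulLog]

lemma Hent_pmfMap_of_injective {α β : Type*} [Fintype α] [Fintype β] {f : α → β}
    (hf : f.Injective) (q : α → ℝ) : Hent (pmfMap f q) = Hent q := by
  rw [Hent_pmfMap]
  simp [pmfMap_apply_of_injective hf, Hent, Real.negMulLog]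

/-- Submodularity of entropy: if `u` and `v` jointly determine the outcome and both determine `w`,
then `H(w) + H(q) ≤ H(u) + H(v)`. -/
lemma Hent_submodular {Ω U V Z : Type*} [Fintype Ω] [Fintype U] [Fintype V] [Fintype Z]
    {q : Ω → ℝ} (hq : ∀ ω, 0 ≤ q ω) (u : Ω → U) (v : Ω → V) (w : Ω → Z) (a : U → Z) (b : V → Z)
    (hau : a ∘ u = w) (hbv : b ∘ v = w) (hinj : Function.Injective fun ω => (u ω, v ω)) :
    Hent (pmfMap w q) + Hent q ≤ Hent (pmfMap u q) + Hent (pmfMap v q) := by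
  let F : U × V → ℝ := fun x =>
    if b x.2 = a x.1 then pmfMap u q x.1 * pmfMap v q x.2 / pmfMap w q (a x.1) else 0
  have hF (x) : 0 ≤ F x := by
    dsimp only [F]
    split_ifs
    · exact div_nonneg (mul_nonneg (pmfMap_nonneg _ hq _) (pmfMap_nonneg _ hq _))
        (pmfMap_nonneg _ hq _)
    · rfl
  have hFω (ω) : F (u ω, v ω) =
      pmfMap u q (u ω) * pmfMap v q (v ω) / pmfMap w q (w ω) := by
    have h1 : a (u ω) = w ω := congrFun hau ω
    have h2 : b (v ω) = w ω := congrFun hbv ω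
    simp [F, h1, h2]
  have hsum : ∑ ω, F (u ω, v ω) ≤ ∑ ω, q ω := calc
    ∑ ω, F (u ω, v ω) = ∑ x ∈ Finset.univ.image fun ω => (u ω, v ω), F x :=
      (Finset.sum_image fun _ _ _ _ h => hinj h).symm
    _ ≤ ∑ x, F x := Finset.sum_le_sum_of_subset_of_nonneg (Finset.subset_univ _) fun x _ _ => hF x
    _ = ∑ x, pmfMap u q x / pmfMap w q (a x) * pmfMap w q (a x) := by
      rw [Fintype.sum_prod_type]
      refine Finset.sum_congr rfl fun x _ => ?_
      have hw : pmfMap w q (a x) = ∑ y, if b y = a x then pmfMap v q y else 0 := by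
        rw [← hbv, ← pmfMap_comp]
        rfl
      conv_rhs => enter [2]; rw [hw]
      rw [Finset.mul_sum]
      refine Finset.sum_congr rfl fun y _ => ?_
      dsimp only [F]
      split_ifs
      · rw [mul_div_right_comm]
      · simp
    _ ≤ ∑ x, pmfMap u q x := by
      refine Finset.sum_le_sum fun x _ => ?_
      by_cases h : pmfMap w q (a x) = 0
      · simpa [h] using pmfMap_nonneg u hq x
      · rw [div_mul_cancel₀ _ h]
    _ = ∑ ω, q ω := sum_pmfMap u q
  have hpt (ω) : q ω - F (u ω, v ω) ≤ q ω * Real.log (q ω) + q ω * Real.log (pmfMap w q (w ω))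
      - q ω * Real.log (pmfMap u q (u ω)) - q ω * Real.log (pmfMap v q (v ω)) := by
    rcases (hq ω).eq_or_lt with h | h
    · simpa [← h] using hF _
    have hu := h.trans_le (le_pmfMap u hq ω)
    have hv := h.trans_le (le_pmfMap v hq ω)
    have hw := h.trans_le (le_pmfMap w hq ω)
    rw [hFω]
    set A := pmfMap u q (u ω)
    set B := pmfMap v q (v ω)
    set C := pmfMap w q (w ω)
    have hlog := Real.log_le_sub_one_of_pos (show 0 < A * B / C / q ω by positivity)
    rw [Real.log_div (by positivity) h.ne', Real.log_div (by positivity) hw.ne',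
      Real.log_mul hu.ne' hv.ne'] at hlog
    have := mul_le_mul_of_nonneg_left hlog h.le
    rw [mul_sub _ (A * B / C / q ω), mul_div_cancel₀ _ h.ne'] at this
    linarith
  have htot := Finset.sum_le_sum fun ω (_ : ω ∈ Finset.univ) => hpt ω
  simp only [Finset.sum_sub_distrib, Finset.sum_add_distrib] at htot
  have hHq : Hent q = -∑ ω, q ω * Real.log (q ω) := by simp [Hent, Real.negMulLog]
  rw [Hent_pmfMap u, Hent_pmfMap v, Hent_pmfMap w, hHq]
  linarith

lemma miW_nonneg {α β W : Type*} [Fintype α] [Fintype β] [Fintype W]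
    {q : (α × β) × W → ℝ} (hq : IsPMF q) : 0 ≤ miW q := by
  have h := Hent_submodular hq.1 Prod.fst Prod.snd (fun _ => ()) (fun _ => ()) (fun _ => ())
    rfl rfl fun _ _ h => h
  have h0 : Hent (pmfMap (fun _ => ()) q) = 0 := by simp [Hent, pmfMap, hq.2]
  unfold miW
  linarith

lemma mi_sub_cmi_le_miW {α β W : Type*} [Fintype α] [Fintype β] [Fintype W]
    {q : (α × β) × W → ℝ} (hq : ∀ x, 0 ≤ q x) :
    mi (pmfMap Prod.fst q) - cmi q ≤ miW q := by
  have hX := Hent_submodular hq Prod.fst (fun x => (x.1.1, x.2)) (fun x => x.1.1)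
    Prod.fst Prod.fst rfl rfl fun x y h => by
      simp only [Prod.mk.injEq] at h
      exact Prod.ext h.1 h.2.2
  have hY := Hent_submodular hq Prod.fst (fun x => (x.1.2, x.2)) (fun x => x.1.2)
    Prod.snd Prod.fst rfl rfl fun x y h => by
      simp only [Prod.mk.injEq] at h
      exact Prod.ext h.1 h.2.2
  simp only [mi, cmi, miW, pmfMap_comp, Function.comp_def]
  linarith

/-- The choice `W = (X,Y)` is always feasible. -/
lemma relaxedSet_nonempty {α β : Type*} [Fintype α] [Fintype β] {p : α × β → ℝ} (hp : IsPMF p)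
    {γ : ℝ} (hγ : 0 ≤ γ) : (relaxedSet p γ).Nonempty := by
  let e := Fintype.equivFin (α × β)
  refine ⟨_, _, pmfMap (fun x => (x, e x)) p, hp.pmfMap _, ?_, ?_, rfl⟩
  · simp only [pmfMap_comp, Function.comp_def, pmfMap_id]
  · have hX : Function.Injective fun x => (x.1, e x) :=
      fun x y h => e.injective (Prod.ext_iff.1 h).2
    have hY : Function.Injective fun x => (x.2, e x) :=
      fun x y h => e.injective (Prod.ext_iff.1 h).2
    have hXY : Function.Injective fun x => (x, e x) := fun x y h => (Prod.ext_iff.1 h).1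
    simp only [cmi, pmfMap_comp, Function.comp_def]
    rw [Hent_pmfMap_of_injective hX, Hent_pmfMap_of_injective hY,
      Hent_pmfMap_of_injective e.injective, Hent_pmfMap_of_injective hXY]
    simpa using hγ

/-- If `I(X;Y) ≤ γ`, a constant `W` is feasible. -/
lemma zero_mem_relaxedSet {α β : Type*} [Fintype α] [Fintype β] {p : α × β → ℝ} (hp : IsPMF p)
    {γ : ℝ} (h : mi p ≤ γ) : 0 ∈ relaxedSet p γ := by
  have hfst : pmfMap Prod.fst (pmfMap (fun x => (x, (0 : Fin 1))) p) = p := by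
    simp only [pmfMap_comp, Function.comp_def, pmfMap_id]
  have hq := Hent_pmfMap_of_injective (Prod.mk_left_injective (0 : Fin 1)) p
  have hconst : Hent (pmfMap (fun _ => (0 : Fin 1)) p) = 0 := by
    simp [Hent, pmfMap, hp.2]
  refine ⟨1, pmfMap (fun x => (x, 0)) p, hp.pmfMap _, hfst, ?_, ?_⟩
  · have h1 := Hent_pmfMap_of_injective (Prod.mk_left_injective (0 : Fin 1)) (pmfMap Prod.fst p)
    have h2 := Hent_pmfMap_of_injective (Prod.mk_left_injective (0 : Fin 1)) (pmfMap Prod.snd p)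
    simp only [pmfMap_comp, Function.comp_def] at h1 h2
    simp only [cmi, pmfMap_comp, Function.comp_def, h1, h2, hq, hconst]
    simpa [mi] using h
  · rw [miW, hfst, hq]
    simp only [pmfMap_comp, Function.comp_def, hconst]
    ring

/-- For finite-alphabet `X, Y` and `γ ≥ 0`: `C_γ(X;Y) ≥ 0`, with equality
if and only if `γ ≥ I(X;Y)`. -/
theorem relaxedWyner_nonneg_iff
    {α β : Type*} [Fintype α] [Fintype β] (p : α × β → ℝ) (hp : IsPMF p)
    (γ : ℝ) (hγ : 0 ≤ γ) :
    0 ≤ Cgamma p γ ∧ (Cgamma p γ = 0 ↔ mi p ≤ γ) := by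
  have hnonneg : ∀ c ∈ relaxedSet p γ, 0 ≤ c := by
    rintro _ ⟨m, q, hq, -, -, rfl⟩
    exact miW_nonneg hq
  have h0 : 0 ≤ Cgamma p γ := Real.sInf_nonneg hnonneg
  refine ⟨h0, fun hC => ?_, fun h =>
    le_antisymm (csInf_le ⟨0, hnonneg⟩ (zero_mem_relaxedSet hp h)) h0⟩
  have hle : mi p - γ ≤ Cgamma p γ := by
    refine le_csInf (relaxedSet_nonempty hp hγ) ?_
    rintro _ ⟨m, q, hq, rfl, hcmi, rfl⟩
    linarith [mi_sub_cmi_le_miW hq.1]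
  linarith
end

section
/- Wyner's common information of the doubly symmetric binary source: let (X,Y) be binary random variables where X is uniform on {0,1} and Y is the output of a binary symmetric channel with crossover probability a₀ ≤ 1/2 applied to X (so P(X ≠ Y) = a₀). Then C(X;Y) = 1 + h_b(a₀) − 2·h_b( (1 − √(1 − 2a₀)) / 2 ), where h_b(p) = −p·log₂ p − (1−p)·log₂(1−p) is the binary entropy function and the common information is measured in bits. -/
open scoped BigOperators
open Classical

/-- The binary entropy function `h_b(p) = -p·log₂ p - (1-p)·log₂(1-p)` (in bits). -/
noncomputable def binEnt (x : ℝ) : ℝ :=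
  -x * Real.logb 2 x - (1 - x) * Real.logb 2 (1 - x)


namespace Real

theorem hasSum_one_add_mul_log_add_one_sub_mul_log {u : ℝ} (hu : |u| < 1) :
    HasSum (fun k : ℕ => 1 / ((2 * (k : ℝ) + 1) * (k + 1)) * (u ^ 2) ^ (k + 1))
      ((1 + u) * log (1 + u) + (1 - u) * log (1 - u)) := by
  have hsq : |u ^ 2| < 1 := by
    rw [abs_pow]; exact pow_lt_one₀ (abs_nonneg u) hu two_ne_zero
  obtain ⟨hl, hr⟩ := abs_lt.mp hu
  have h1 := (hasSum_log_sub_log_of_abs_lt_one hu).mul_left u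
  have h2 := hasSum_pow_div_log_of_abs_lt_one hsq
  have hterm : (fun k : ℕ => 1 / ((2 * (k : ℝ) + 1) * (k + 1)) * (u ^ 2) ^ (k + 1)) =
      fun k : ℕ =>
      u * (2 * (1 / (2 * (k : ℝ) + 1)) * u ^ (2 * k + 1)) - (u ^ 2) ^ (k + 1) / (k + 1) := by
    funext k
    have : (2 * (k : ℝ) + 1) ≠ 0 := by positivity
    have : ((k : ℝ) + 1) ≠ 0 := by positivity
    rw [← pow_mul]
    field_simp
    ring
  have hlog : (1 + u) * log (1 + u) + (1 - u) * log (1 - u) =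
      u * (log (1 + u) - log (1 - u)) - -log (1 - u ^ 2) := by
    rw [show 1 - u ^ 2 = (1 + u) * (1 - u) by ring,
      log_mul (by linarith) (by linarith)]
    ring
  rw [hterm, hlog]
  exact h1.sub h2

theorem binEntropy_one_sub_div_two {u : ℝ} (hu : |u| < 1) :
    binEntropy ((1 - u) / 2) =
      log 2 - ((1 + u) * log (1 + u) + (1 - u) * log (1 - u)) / 2 := by
  obtain ⟨hl, hr⟩ := abs_lt.mp hu
  rw [binEntropy_eq_negMulLog_add_negMulLog_one_sub, negMulLog, negMulLog,
    show 1 - (1 - u) / 2 = (1 + u) / 2 by ring,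
    log_div (by linarith) two_ne_zero, log_div (by linarith) two_ne_zero]
  ring

theorem hasSum_binEntropy_one_sub_sqrt_div_two {t : ℝ} (h0 : 0 ≤ t) (h1 : t < 1) :
    HasSum (fun k : ℕ => 1 / ((2 * (k : ℝ) + 1) * (k + 1)) * t ^ (k + 1))
      (2 * (log 2 - binEntropy ((1 - √t) / 2))) := by
  have hu : |√t| < 1 := by
    rw [abs_of_nonneg (sqrt_nonneg t), sqrt_lt' one_pos]; simpa using h1
  have h := hasSum_one_add_mul_log_add_one_sub_mul_log hu
  rw [sq_sqrt h0] at h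
  convert h using 1
  rw [binEntropy_one_sub_div_two hu]
  ring

theorem concaveOn_binEntropy_one_sub_sqrt_div_two :
    ConcaveOn ℝ (Set.Icc 0 1) (fun t => binEntropy ((1 - √t) / 2)) := by
  have hIco : ∀ x ∈ Set.Ico (0 : ℝ) 1, ∀ y ∈ Set.Ico (0 : ℝ) 1, ∀ a b : ℝ, 0 ≤ a → 0 ≤ b →
      a + b = 1 → a * binEntropy ((1 - √x) / 2) + b * binEntropy ((1 - √y) / 2) ≤
        binEntropy ((1 - √(a * x + b * y)) / 2) := by
    intro x hx y hy a b ha hb hab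
    have hz : a * x + b * y ∈ Set.Ico (0 : ℝ) 1 := convex_Ico (0 : ℝ) 1 hx hy ha hb hab
    have sx := (hasSum_binEntropy_one_sub_sqrt_div_two hx.1 hx.2).mul_left a
    have sy := (hasSum_binEntropy_one_sub_sqrt_div_two hy.1 hy.2).mul_left b
    have h := hasSum_le (fun k => ?_) (hasSum_binEntropy_one_sub_sqrt_div_two hz.1 hz.2)
      (sx.add sy)
    · have e : log 2 = a * log 2 + b * log 2 := by rw [← add_mul, hab, one_mul]
      linarith
    · have hc := (convexOn_pow (𝕜 := ℝ) (k + 1)).2 (Set.mem_Ici.mpr hx.1)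
        (Set.mem_Ici.mpr hy.1) ha hb hab
      simp only [smul_eq_mul] at hc
      have hk : (0 : ℝ) ≤ 1 / ((2 * (k : ℝ) + 1) * (k + 1)) := by positivity
      nlinarith [mul_le_mul_of_nonneg_left hc hk]
  refine ⟨convex_Icc 0 1, fun x hx y hy a b ha hb hab => ?_⟩
  simp only [smul_eq_mul]
  have hcont : ∀ f : ℝ → ℝ, Continuous f → Filter.Tendsto
      (fun r => binEntropy ((1 - √(f r)) / 2)) (nhdsWithin 1 (Set.Iio 1))
      (nhds (binEntropy ((1 - √(f 1)) / 2))) := fun f hf =>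
    ((by fun_prop : Continuous fun r => binEntropy ((1 - √(f r)) / 2)).tendsto 1).mono_left
      nhdsWithin_le_nhds
  have tx := hcont (fun r => r * x) (by fun_prop)
  have ty := hcont (fun r => r * y) (by fun_prop)
  have tz := hcont (fun r => a * (r * x) + b * (r * y)) (by fun_prop)
  simp only [one_mul] at tx ty tz
  refine le_of_tendsto_of_tendsto ((tx.const_mul a).add (ty.const_mul b)) tz ?_
  filter_upwards [Ioo_mem_nhdsLT (zero_lt_one' ℝ)] with r hr
  have hmem : ∀ z ∈ Set.Icc (0 : ℝ) 1, r * z ∈ Set.Ico (0 : ℝ) 1 := fun z hz =>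
    ⟨mul_nonneg hr.1.le hz.1, by nlinarith [hz.1, hz.2, hr.1, hr.2]⟩
  exact hIco _ (hmem x hx) _ (hmem y hy) a b ha hb hab

theorem antitoneOn_binEntropy_one_sub_sqrt_div_two :
    AntitoneOn (fun t => binEntropy ((1 - √t) / 2)) (Set.Icc 0 1) := by
  intro x hx y hy hxy
  have hs := sqrt_le_sqrt hxy
  have h1 : √y ≤ 1 := sqrt_le_one.mpr hy.2
  have h0 := sqrt_nonneg x
  refine binEntropy_strictMonoOn.monotoneOn ?_ ?_ (by linarith) <;>
    constructor <;> linarith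

theorem binEntropy_one_sub_abs_div_two (u : ℝ) :
    binEntropy ((1 - |u|) / 2) = binEntropy ((1 - u) / 2) := by
  rcases abs_choice u with h | h <;> rw [h]
  rw [← binEntropy_one_sub]
  congr 1
  ring

/-- Two-letter form of Wyner's inequality: geometric mean bias increases entropy. -/
theorem binEntropy_add_binEntropy_le {u v : ℝ} (hu : |u| ≤ 1) (hv : |v| ≤ 1) :
    binEntropy ((1 - u) / 2) + binEntropy ((1 - v) / 2) ≤
      2 * binEntropy ((1 - √|u * v|) / 2) := by
  have hmem : ∀ z : ℝ, |z| ≤ 1 → z ^ 2 ∈ Set.Icc (0 : ℝ) 1 := fun z hz =>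
    ⟨sq_nonneg z, (sq_le_one_iff_abs_le_one z).mpr hz⟩
  have half : (0 : ℝ) ≤ 1 / 2 := by norm_num
  have hc := concaveOn_binEntropy_one_sub_sqrt_div_two.2 (hmem u hu) (hmem v hv)
    half half (by norm_num)
  have huv : |u * v| ∈ Set.Icc (0 : ℝ) 1 :=
    ⟨abs_nonneg _, by rw [abs_mul]; exact mul_le_one₀ hu (abs_nonneg v) hv⟩
  have hm := antitoneOn_binEntropy_one_sub_sqrt_div_two huv
    (concaveOn_binEntropy_one_sub_sqrt_div_two.1 (hmem u hu) (hmem v hv)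
      half half (by norm_num))
    (by
      simp only [smul_eq_mul]
      rw [abs_mul]
      nlinarith [sq_nonneg (|u| - |v|), sq_abs u, sq_abs v])
  simp only [smul_eq_mul, sqrt_sq_eq_abs, binEntropy_one_sub_abs_div_two] at hc hm
  linarith

theorem negMulLog_add_negMulLog_sub {x y : ℝ} (hx : 0 ≤ x) (hy : 0 ≤ y) :
    negMulLog x + negMulLog y - negMulLog (x + y) =
      (x + y) * binEntropy ((1 - (y - x) / (x + y)) / 2) := by
  rcases (add_nonneg hx hy).eq_or_lt' with h | h
  · obtain rfl : x = 0 := by linarith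
    obtain rfl : y = 0 := by linarith
    simp
  · have hx' : x = (x + y) * (x / (x + y)) := by field_simp
    have hy' : y = (x + y) * (y / (x + y)) := by field_simp
    have e1 : (1 - (y - x) / (x + y)) / 2 = x / (x + y) := by field_simp; ring
    have e2 : 1 - x / (x + y) = y / (x + y) := by field_simp; ring
    rw [e1, binEntropy_eq_negMulLog_add_negMulLog_one_sub, e2]
    have m1 := negMulLog_mul (x + y) (x / (x + y))
    have m2 := negMulLog_mul (x + y) (y / (x + y))
    rw [← hx'] at m1
    rw [← hy'] at m2
    rw [m1, m2]
    have : x / (x + y) + y / (x + y) = 1 := by field_simp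
    linear_combination negMulLog (x + y) * this

theorem sub_le_mul_log_of_le {x R C p : ℝ} (hx : 0 ≤ x) (hR : x ≤ R) (hC : x ≤ C) (hp : 0 < p) :
    x - R * C / p ≤ x * (log x + log p - log R - log C) ∧
      (x - R * C / p = x * (log x + log p - log R - log C) → x = R * C / p) := by
  rcases hx.eq_or_lt with rfl | hx
  · have : 0 ≤ R * C / p := by positivity
    exact ⟨by simpa using this, fun h => by linarith⟩
  · have hR' := hx.trans_le hR
    have hC' := hx.trans_le hC
    have hy : 0 < R * C / p / x := by positivity
    have hlog : log (R * C / p / x) = -(log x + log p - log R - log C) := by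
      rw [log_div (by positivity) hx.ne', log_div (by positivity) hp.ne',
        log_mul hR'.ne' hC'.ne']
      ring
    have hmul : x * (R * C / p / x) = R * C / p := by field_simp
    refine ⟨?_, fun h => ?_⟩
    · have := mul_le_mul_of_nonneg_left (log_le_sub_one_of_pos hy) hx.le
      rw [hlog, mul_sub, hmul] at this
      linarith
    · by_contra hne
      have hne' : R * C / p / x ≠ 1 := fun h1 => hne (by rw [← hmul, h1, mul_one])
      have := mul_lt_mul_of_pos_left (log_lt_sub_one_of_pos hy hne') hx
      rw [hlog, mul_sub, hmul] at this
      linarith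

/-- Nonnegativity of the (unnormalized) mutual information of a `2 × 2` table, with the
equality case. -/
theorem negMulLog_table_nonneg {a b c d : ℝ} (ha : 0 ≤ a) (hb : 0 ≤ b) (hc : 0 ≤ c)
    (hd : 0 ≤ d) :
    0 ≤ negMulLog (a + b) + negMulLog (c + d) + negMulLog (a + c) + negMulLog (b + d)
        - negMulLog (a + b + (c + d))
        - (negMulLog a + negMulLog b + negMulLog c + negMulLog d) ∧
      (negMulLog (a + b) + negMulLog (c + d) + negMulLog (a + c) + negMulLog (b + d)
        - negMulLog (a + b + (c + d))
        - (negMulLog a + negMulLog b + negMulLog c + negMulLog d) = 0 → a * d = b * c) := by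
  rcases (by positivity : 0 ≤ a + b + (c + d)).eq_or_lt' with hp | hp
  · obtain rfl : a = 0 := by linarith
    obtain rfl : b = 0 := by linarith
    obtain rfl : c = 0 := by linarith
    obtain rfl : d = 0 := by linarith
    simp
  · obtain ⟨a1, a2⟩ := sub_le_mul_log_of_le ha (by linarith : a ≤ a + b)
      (by linarith : a ≤ a + c) hp
    obtain ⟨b1, -⟩ := sub_le_mul_log_of_le hb (by linarith : b ≤ a + b)
      (by linarith : b ≤ b + d) hp
    obtain ⟨c1, -⟩ := sub_le_mul_log_of_le hc (by linarith : c ≤ c + d)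
      (by linarith : c ≤ a + c) hp
    obtain ⟨d1, -⟩ := sub_le_mul_log_of_le hd (by linarith : d ≤ c + d)
      (by linarith : d ≤ b + d) hp
    have hsum : (a + b) * (a + c) / (a + b + (c + d)) + (a + b) * (b + d) / (a + b + (c + d))
        + (c + d) * (a + c) / (a + b + (c + d)) + (c + d) * (b + d) / (a + b + (c + d))
        = a + b + (c + d) := by
      field_simp
      ring
    simp only [negMulLog]
    refine ⟨by linarith, fun h => ?_⟩
    have := a2 (by linarith)
    rw [eq_div_iff hp.ne'] at this
    linarith

end Real

theorem binEnt_mul_log_two (x : ℝ) : binEnt x * Real.log 2 = Real.binEntropy x := by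
  have h : Real.log 2 ≠ 0 := (Real.log_pos one_lt_two).ne'
  rw [Real.binEntropy_eq_negMulLog_add_negMulLog_one_sub, binEnt, Real.logb, Real.logb,
    Real.negMulLog, Real.negMulLog]
  field_simp
  ring

section Marginals

variable {W : Type*} [Fintype W] (q : (Bool × Bool) × W → ℝ)

theorem pmfMap_fst_apply (z : Bool × Bool) : pmfMap Prod.fst q z = ∑ w, q (z, w) := by
  rw [pmfMap, Fintype.sum_prod_type, Fintype.sum_eq_single z fun z' hz' => by simp [hz']]
  simp

theorem Hent_eq_sum_table : Hent q = ∑ w, (Real.negMulLog (q ((true, true), w)) +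
    Real.negMulLog (q ((true, false), w)) + Real.negMulLog (q ((false, true), w)) +
    Real.negMulLog (q ((false, false), w))) := by
  simp only [Hent, Fintype.sum_prod_type_right, Fintype.sum_bool]
  exact Finset.sum_congr rfl fun w _ => by ring

theorem Hent_pmfMap_snd : Hent (pmfMap Prod.snd q) = ∑ w, Real.negMulLog
    (q ((true, true), w) + q ((true, false), w) +
      (q ((false, true), w) + q ((false, false), w))) := by
  refine Finset.sum_congr rfl fun w _ => ?_
  congr 1
  simp only [pmfMap, Fintype.sum_prod_type, Finset.sum_ite_eq', Finset.mem_univ, if_true,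
    Fintype.sum_bool]

theorem Hent_pmfMap_fst_snd : Hent (pmfMap (fun x => (x.1.1, x.2)) q) =
    ∑ w, (Real.negMulLog (q ((true, true), w) + q ((true, false), w)) +
      Real.negMulLog (q ((false, true), w) + q ((false, false), w))) := by
  simp only [Hent, pmfMap, Fintype.sum_prod_type_right, Fintype.sum_bool, Prod.mk.injEq]
  refine Finset.sum_congr rfl fun w _ => ?_
  simp [Finset.sum_add_distrib, add_comm]

theorem Hent_pmfMap_snd_snd : Hent (pmfMap (fun x => (x.1.2, x.2)) q) =
    ∑ w, (Real.negMulLog (q ((true, true), w) + q ((false, true), w)) +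
      Real.negMulLog (q ((true, false), w) + q ((false, false), w))) := by
  simp only [Hent, pmfMap, Fintype.sum_prod_type_right, Fintype.sum_bool, Prod.mk.injEq]
  refine Finset.sum_congr rfl fun w _ => ?_
  simp [Finset.sum_add_distrib, add_comm]

theorem cmi_eq_sum_table : cmi q = ∑ w,
    (Real.negMulLog (q ((true, true), w) + q ((true, false), w)) +
      Real.negMulLog (q ((false, true), w) + q ((false, false), w)) +
      Real.negMulLog (q ((true, true), w) + q ((false, true), w)) +
      Real.negMulLog (q ((true, false), w) + q ((false, false), w)) -
      Real.negMulLog (q ((true, true), w) + q ((true, false), w) +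
        (q ((false, true), w) + q ((false, false), w))) -
      (Real.negMulLog (q ((true, true), w)) + Real.negMulLog (q ((true, false), w)) +
        Real.negMulLog (q ((false, true), w)) + Real.negMulLog (q ((false, false), w)))) := by
  rw [cmi, Hent_pmfMap_fst_snd, Hent_pmfMap_snd_snd, Hent_pmfMap_snd, Hent_eq_sum_table,
    ← Finset.sum_add_distrib, ← Finset.sum_sub_distrib, ← Finset.sum_sub_distrib]
  exact Finset.sum_congr rfl fun w _ => by ring

variable {q}

theorem mul_eq_mul_of_cmi_eq_zero (hq : ∀ z, 0 ≤ q z) (h : cmi q = 0) (w : W) :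
    q ((true, true), w) * q ((false, false), w) =
      q ((true, false), w) * q ((false, true), w) := by
  rw [cmi_eq_sum_table, Finset.sum_eq_zero_iff_of_nonneg fun w _ =>
    (Real.negMulLog_table_nonneg (hq _) (hq _) (hq _) (hq _)).1] at h
  exact (Real.negMulLog_table_nonneg (hq _) (hq _) (hq _) (hq _)).2 (h w (Finset.mem_univ w))

end Marginals

/-- For an independent `2 × 2` table the conditional entropy is controlled by the product of the
two biases. -/
theorem negMulLog_table_sub_le {a b c d : ℝ} (ha : 0 ≤ a) (hb : 0 ≤ b) (hc : 0 ≤ c)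
    (hd : 0 ≤ d) (had : a * d = b * c) :
    ∃ t ∈ Set.Icc (0 : ℝ) 1, a + d - (b + c) ≤ (a + b + (c + d)) * t ∧
      Real.negMulLog (a + b) + Real.negMulLog (c + d) + Real.negMulLog (a + c) +
          Real.negMulLog (b + d) - 2 * Real.negMulLog (a + b + (c + d)) ≤
        (a + b + (c + d)) * (2 * Real.binEntropy ((1 - √t) / 2)) := by
  have hp : 0 ≤ a + b + (c + d) := by positivity
  have key : ∀ x y : ℝ, 0 ≤ x → 0 ≤ y → |(y - x) / (x + y)| ≤ 1 := fun x y hx hy => by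
    rw [abs_div, abs_of_nonneg (add_nonneg hx hy)]
    exact div_le_one_of_le₀ (abs_le.mpr ⟨by linarith, by linarith⟩) (add_nonneg hx hy)
  have hu := key (a + b) (c + d) (by positivity) (by positivity)
  have hv := key (a + c) (b + d) (by positivity) (by positivity)
  have e1 := Real.negMulLog_add_negMulLog_sub (add_nonneg ha hb) (add_nonneg hc hd)
  have e2 := Real.negMulLog_add_negMulLog_sub (add_nonneg ha hc) (add_nonneg hb hd)
  have hpp : a + c + (b + d) = a + b + (c + d) := by ring
  rw [hpp] at hv e2
  have hle := mul_le_mul_of_nonneg_left (Real.binEntropy_add_binEntropy_le hu hv) hp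
  refine ⟨|(c + d - (a + b)) / (a + b + (c + d)) * ((b + d - (a + c)) / (a + b + (c + d)))|,
    ⟨abs_nonneg _, ?_⟩, ?_, ?_⟩
  rotate_right
  · rw [mul_add, ← e1, ← e2] at hle
    linarith
  · rw [abs_mul]
    exact mul_le_one₀ hu (abs_nonneg _) hv
  · rcases hp.eq_or_lt' with h | h
    · rw [h, zero_mul]
      linarith
    · refine le_trans (le_of_eq ?_) (mul_le_mul_of_nonneg_left (le_abs_self _) hp)
      field_simp
      linear_combination 4 * had

/-- The joint pmf of the doubly symmetric binary source with crossover probability `a`. -/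
noncomputable def dsbs (a : ℝ) : Bool × Bool → ℝ :=
  fun xy => if xy.1 = xy.2 then (1 - a) / 2 else a / 2

theorem Hent_dsbs (a : ℝ) : Hent (dsbs a) = Real.log 2 + Real.binEntropy a := by
  have h : ∀ x : ℝ, Real.negMulLog (x / 2) = Real.negMulLog x / 2 + x * (Real.log 2 / 2) :=
    fun x => by
      rw [div_eq_mul_inv, Real.negMulLog_mul]
      simp only [Real.negMulLog, Real.log_inv]
      ring
  simp only [Hent, dsbs, Fintype.sum_prod_type, Fintype.sum_bool, h,
    Real.binEntropy_eq_negMulLog_add_negMulLog_one_sub, reduceCtorEq, if_true, if_false]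
  ring

theorem le_miW_of_cmi_eq_zero {a : ℝ} (h12 : a ≤ 1 / 2) {W : Type*} [Fintype W]
    {q : (Bool × Bool) × W → ℝ} (hq : IsPMF q) (hm : pmfMap Prod.fst q = dsbs a)
    (hc : cmi q = 0) :
    Real.log 2 + Real.binEntropy a - 2 * Real.binEntropy ((1 - √(1 - 2 * a)) / 2) ≤ miW q := by
  have hmarg : ∀ z, ∑ w, q (z, w) = dsbs a z := fun z => by rw [← hm, pmfMap_fst_apply]
  choose t ht hbias hent using fun w => negMulLog_table_sub_le (hq.1 ((true, true), w))
    (hq.1 ((true, false), w)) (hq.1 ((false, true), w)) (hq.1 ((false, false), w))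
    (mul_eq_mul_of_cmi_eq_zero hq.1 hc w)
  have hpsum : ∑ w, (q ((true, true), w) + q ((true, false), w) +
      (q ((false, true), w) + q ((false, false), w))) = 1 := by
    simp only [Finset.sum_add_distrib, hmarg, dsbs, reduceCtorEq, if_true, if_false]
    ring
  have hp : ∀ w ∈ Finset.univ, 0 ≤ q ((true, true), w) + q ((true, false), w) +
      (q ((false, true), w) + q ((false, false), w)) := fun w _ =>
    add_nonneg (add_nonneg (hq.1 _) (hq.1 _)) (add_nonneg (hq.1 _) (hq.1 _))
  have hbias' := Finset.sum_le_sum fun w (_ : w ∈ Finset.univ) => hbias w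
  simp only [Finset.sum_add_distrib, Finset.sum_sub_distrib, hmarg, dsbs, reduceCtorEq, if_true,
    if_false] at hbias'
  have hJ := Real.concaveOn_binEntropy_one_sub_sqrt_div_two.le_map_sum hp hpsum fun w _ => ht w
  have hmem := Real.concaveOn_binEntropy_one_sub_sqrt_div_two.1.sum_mem hp hpsum fun w _ => ht w
  simp only [smul_eq_mul] at hJ hmem
  have h1 : 1 - 2 * a ≤ ∑ w, (q ((true, true), w) + q ((true, false), w) +
      (q ((false, true), w) + q ((false, false), w))) * t w := by linarith
  have hA := Real.antitoneOn_binEntropy_one_sub_sqrt_div_two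
    ⟨by linarith, h1.trans hmem.2⟩ hmem h1
  simp only at hA
  have hE := Finset.sum_le_sum fun w (_ : w ∈ Finset.univ) => hent w
  have hcond : Hent q - Hent (pmfMap Prod.snd q) ≤
      ∑ w, (q ((true, true), w) + q ((true, false), w) +
      (q ((false, true), w) + q ((false, false), w))) *
        (2 * Real.binEntropy ((1 - √(t w)) / 2)) := by
    refine le_trans (le_of_eq ?_) hE
    have : Hent q = Hent (pmfMap (fun x => (x.1.1, x.2)) q) +
      Hent (pmfMap (fun x => (x.1.2, x.2)) q) - Hent (pmfMap Prod.snd q) := by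
      unfold cmi at hc
      linarith
    rw [this, Hent_pmfMap_fst_snd, Hent_pmfMap_snd_snd, Hent_pmfMap_snd]
    simp only [Finset.sum_add_distrib, Finset.sum_sub_distrib, ← Finset.mul_sum]
    ring
  have hdouble : ∑ w, (q ((true, true), w) + q ((true, false), w) +
      (q ((false, true), w) + q ((false, false), w))) *
        (2 * Real.binEntropy ((1 - √(t w)) / 2)) =
      2 * ∑ w, (q ((true, true), w) + q ((true, false), w) +
      (q ((false, true), w) + q ((false, false), w))) *
        Real.binEntropy ((1 - √(t w)) / 2) := by
    rw [Finset.mul_sum]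
    exact Finset.sum_congr rfl fun w _ => by ring
  rw [miW, hm, Hent_dsbs]
  linarith

/-- The optimal coupling: `W` is a uniform bit, and `X`, `Y` are independent outputs of binary
symmetric channels with crossover probability `b` applied to `W`. -/
noncomputable def bscCoupling (b : ℝ) : (Bool × Bool) × Fin 2 → ℝ :=
  fun z => 1 / 2 * ((if z.1.1 = (z.2 == 0) then 1 - b else b) *
    (if z.1.2 = (z.2 == 0) then 1 - b else b))

theorem isPMF_bscCoupling {b : ℝ} (h0 : 0 ≤ b) (h1 : b ≤ 1) : IsPMF (bscCoupling b) := by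
  constructor
  · intro z
    have : 0 ≤ 1 - b := by linarith
    unfold bscCoupling
    split_ifs <;> positivity
  · simp [bscCoupling, Fintype.sum_prod_type]
    ring

theorem pmfMap_fst_bscCoupling (b : ℝ) :
    pmfMap Prod.fst (bscCoupling b) = dsbs (2 * (b * (1 - b))) := by
  funext ⟨x, y⟩
  rw [pmfMap_fst_apply]
  cases x <;> cases y <;> simp [bscCoupling, dsbs] <;> ring

theorem cmi_bscCoupling (b : ℝ) : cmi (bscCoupling b) = 0 := by
  have r1 : ∀ x : ℝ, x * (1 - b) + x * b = x := fun x => by ring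
  have r2 : ∀ x : ℝ, x * b + x * (1 - b) = x := fun x => by ring
  have e1 : 1 / 2 * ((1 - b) * (1 - b)) + 1 / 2 * ((1 - b) * b) = 1 / 2 * (1 - b) := by ring
  have e2 : 1 / 2 * (b * (1 - b)) + 1 / 2 * (b * b) = 1 / 2 * b := by ring
  have e3 : 1 / 2 * ((1 - b) * (1 - b)) + 1 / 2 * (b * (1 - b)) = 1 / 2 * (1 - b) := by ring
  have e4 : 1 / 2 * ((1 - b) * b) + 1 / 2 * (b * b) = 1 / 2 * b := by ring
  have e5 : 1 / 2 * (b * b) + 1 / 2 * (b * (1 - b)) = 1 / 2 * b := by ring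
  have e6 : 1 / 2 * ((1 - b) * b) + 1 / 2 * ((1 - b) * (1 - b)) = 1 / 2 * (1 - b) := by ring
  have e7 : 1 / 2 * (b * b) + 1 / 2 * ((1 - b) * b) = 1 / 2 * b := by ring
  have e8 : 1 / 2 * (b * (1 - b)) + 1 / 2 * ((1 - b) * (1 - b)) = 1 / 2 * (1 - b) := by ring
  rw [cmi_eq_sum_table, Fin.sum_univ_two]
  simp only [bscCoupling, beq_self_eq_true, if_true, reduceCtorEq, if_false, Fin.isValue,
    show ((1 : Fin 2) == 0) = false from rfl, e1, e2, e3, e4, e5, e6, e7, e8, r1, r2,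
    Real.negMulLog_mul]
  ring

theorem miW_bscCoupling (b : ℝ) : miW (bscCoupling b) =
    Real.log 2 + Real.binEntropy (2 * (b * (1 - b))) - 2 * Real.binEntropy b := by
  have e : 1 / 2 * ((1 - b) * (1 - b)) + 1 / 2 * ((1 - b) * b) +
      (1 / 2 * (b * (1 - b)) + 1 / 2 * (b * b)) = 1 / 2 := by ring
  have e' : 1 / 2 * (b * b) + 1 / 2 * (b * (1 - b)) +
      (1 / 2 * ((1 - b) * b) + 1 / 2 * ((1 - b) * (1 - b))) = 1 / 2 := by ring
  rw [miW, pmfMap_fst_bscCoupling, Hent_dsbs, Hent_pmfMap_snd, Hent_eq_sum_table,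
    Fin.sum_univ_two, Fin.sum_univ_two]
  simp only [bscCoupling, beq_self_eq_true, if_true, reduceCtorEq, if_false, Fin.isValue,
    show ((1 : Fin 2) == 0) = false from rfl, e, e', Real.negMulLog_mul,
    Real.binEntropy_eq_negMulLog_add_negMulLog_one_sub]
  ring

/-- **Wyner's common information of the DSBS.** Let `X` be uniform on `{0,1}` and
`Y` the output of a binary symmetric channel with crossover probability `a₀ ≤ 1/2` applied to
`X`, so that the joint pmf is `p(x,y) = (1-a₀)/2` if `x = y` and `a₀/2` otherwise. Then
`C(X;Y) = 1 + h_b(a₀) − 2·h_b((1 − √(1−2a₀))/2)` bits. (Our `WynerCI` is measured in nats;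
a value of `c` bits corresponds to `c·log 2` nats.) -/
theorem wynerCI_doubly_symmetric_binary_source
    (a₀ : ℝ) (h0 : 0 ≤ a₀) (h12 : a₀ ≤ 1 / 2) :
    WynerCI (fun xy : Bool × Bool => if xy.1 = xy.2 then (1 - a₀) / 2 else a₀ / 2) =
      (1 + binEnt a₀ - 2 * binEnt ((1 - Real.sqrt (1 - 2 * a₀)) / 2)) * Real.log 2 := by
  change WynerCI (dsbs a₀) = _
  rw [sub_mul, add_mul, mul_assoc, binEnt_mul_log_two, binEnt_mul_log_two, one_mul]
  have hs := Real.sq_sqrt (by linarith : 0 ≤ 1 - 2 * a₀)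
  have hs0 := Real.sqrt_nonneg (1 - 2 * a₀)
  have hs1 : √(1 - 2 * a₀) ≤ 1 := Real.sqrt_le_one.mpr (by linarith)
  have ha : 2 * ((1 - √(1 - 2 * a₀)) / 2 * (1 - (1 - √(1 - 2 * a₀)) / 2)) = a₀ := by
    linear_combination (-1 / 2) * hs
  refine IsLeast.csInf_eq ⟨⟨2, bscCoupling ((1 - √(1 - 2 * a₀)) / 2),
    isPMF_bscCoupling (by linarith) (by linarith), ?_, cmi_bscCoupling _, ?_⟩, ?_⟩
  · rw [pmfMap_fst_bscCoupling, ha]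
  · rw [miW_bscCoupling, ha]
  · rintro _ ⟨m, q, hq, hm, hc, rfl⟩
    exact le_miW_of_cmi_eq_zero h12 hq hm hc
end
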